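/- arXiv:1303.4060 — 3 statements merged into one kernel-verified Lean document; each statement's English description precedes it below -/
import Mathlib

section
/- Let m, v ∈ ℝ³ with ‖m‖ = 1 and ⟨m, v⟩ = 0, and let k ≥ 0. Then ‖ (m + k v)/‖m + k v‖ − m ‖ ≤ k ‖v‖. -/
open RealInnerProductSpace

/-- Nodewise estimate for the normalization step of the tangent-plane algorithm:
`‖(m + k v)/‖m + k v‖ − m‖ ≤ k ‖v‖`. -/
theorem stmt4 (m v : EuclideanSpace ℝ (Fin 3)) (hm : ‖m‖ = 1) (hmv : ⟪m, v⟫ = 0)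
    (k : ℝ) (hk : 0 ≤ k) :
    ‖(‖m + k • v‖)⁻¹ • (m + k • v) - m‖ ≤ k * ‖v‖ := by
  have hr2 : ‖m + k • v‖ ^ 2 = 1 + (k * ‖v‖) ^ 2 := by
    rw [norm_add_sq_real, inner_smul_right, hmv, norm_smul, hm, Real.norm_of_nonneg hk]
    ring
  have hin : ⟪m + k • v, m⟫ = 1 := by
    rw [inner_add_left, inner_smul_left, real_inner_comm, real_inner_comm m v, hmv,
      real_inner_self_eq_norm_sq, hm]
    simp
  set w := m + k • v with hw
  have hr1 : 1 ≤ ‖w‖ := by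
    nlinarith [norm_nonneg w, sq_nonneg (k * ‖v‖)]
  have hr0 : 0 < ‖w‖ := by linarith
  have hs : ‖w‖⁻¹ * ‖w‖ = 1 := inv_mul_cancel₀ hr0.ne'
  have hs0 : 0 < ‖w‖⁻¹ := inv_pos.mpr hr0
  have hsq : ‖‖w‖⁻¹ • w - m‖ ^ 2 = 2 - 2 * ‖w‖⁻¹ := by
    rw [norm_sub_sq_real, inner_smul_left, hin, norm_smul, hm, norm_inv, norm_norm, hs]
    simp
    ring
  refine abs_le_of_sq_le_sq' ?_ (by positivity) |>.2
  rw [hsq]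
  have h1 : ‖w‖⁻¹ ≤ 1 := inv_le_one_of_one_le₀ hr1
  have h2 : 1 - ‖w‖⁻¹ ≤ ‖w‖ - 1 := by
    nlinarith [mul_nonneg hs0.le (sq_nonneg (‖w‖ - 1))]
  nlinarith
end

section
/- Let n ∈ ℕ, let γ : Fin n → Fin n → ℝ satisfy γ i j ≤ 0 for all i ≠ j, and let a : Fin n → ℝ³ satisfy ‖a i‖ ≥ 1 for all i. Then ∑_{i ≠ j} (−γ i j) · ‖ a i/‖a i‖ − a j/‖a j‖ ‖² ≤ ∑_{i ≠ j} (−γ i j) · ‖ a i − a j ‖². -/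
open Finset

theorem normalize_aux (x y : EuclideanSpace ℝ (Fin 3)) (hx : 1 ≤ ‖x‖) (hy : 1 ≤ ‖y‖) :
    ‖(‖x‖)⁻¹ • x - (‖y‖)⁻¹ • y‖ ^ 2 ≤ ‖x - y‖ ^ 2 := by
  have hx0 : ‖x‖ ≠ 0 := by positivity
  have hy0 : ‖y‖ ≠ 0 := by positivity
  obtain ⟨t, ht⟩ : ∃ t : ℝ, t = inner ℝ x y / (‖x‖ * ‖y‖) := ⟨_, rfl⟩
  have hc : inner ℝ x y = ‖x‖ * ‖y‖ * t := by rw [ht]; field_simp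
  have ht1 : t ≤ 1 := by
    rw [ht]
    exact div_le_one_of_le₀ (real_inner_le_norm x y) (by positivity)
  have e1 : ‖(‖x‖)⁻¹ • x - (‖y‖)⁻¹ • y‖ ^ 2 = 2 - 2 * t := by
    rw [norm_sub_sq_real, real_inner_smul_left, real_inner_smul_right, hc,
      norm_smul, norm_smul, norm_inv, norm_inv, norm_norm, norm_norm]
    field_simp
    ring
  rw [e1, norm_sub_sq_real, hc]
  have h1 : 1 ≤ ‖x‖ * ‖y‖ := one_le_mul_of_one_le_of_one_le hx hy
  nlinarith [sq_nonneg (‖x‖ - ‖y‖), mul_nonneg (sub_nonneg.2 h1) (sub_nonneg.2 ht1)]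

/-- Discrete form of Bartels' inequality: under the angle condition `γ i j ≤ 0` for `i ≠ j`,
normalizing nodal vectors of norm at least `1` decreases the weighted sum of squared
differences. -/
theorem stmt5 (n : ℕ) (γ : Fin n → Fin n → ℝ) (hγ : ∀ i j : Fin n, i ≠ j → γ i j ≤ 0)
    (a : Fin n → EuclideanSpace ℝ (Fin 3)) (ha : ∀ i : Fin n, 1 ≤ ‖a i‖) :
    ∑ i : Fin n, ∑ j : Fin n,
        (if i ≠ j then (-(γ i j)) * ‖(‖a i‖)⁻¹ • a i - (‖a j‖)⁻¹ • a j‖ ^ 2 else 0) ≤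
      ∑ i : Fin n, ∑ j : Fin n,
        (if i ≠ j then (-(γ i j)) * ‖a i - a j‖ ^ 2 else 0) := by
  refine Finset.sum_le_sum fun i _ => Finset.sum_le_sum fun j _ => ?_
  split_ifs with h
  · exact mul_le_mul_of_nonneg_left (normalize_aux _ _ (ha i) (ha j))
      (neg_nonneg.2 (hγ i j h))
  · exact le_rfl
end

section
/- Let H and K be real inner product spaces, G : H → K a linear map, and let α > 0, C_e > 0, θ ∈ ℝ, k > 0. Let m, v, h, p : ℕ → H be sequences such that for every ℓ: (i) α ‖v_ℓ‖² + C_e θ k ‖G v_ℓ‖² = −C_e ⟨G m_ℓ, G v_ℓ⟩ + ⟨h_ℓ − p_ℓ, v_ℓ⟩, and (ii) ‖G m_{ℓ+1}‖ ≤ ‖G m_ℓ + k G v_ℓ‖. Then for every 0 < ν < α and every j ∈ ℕ: ½‖G m_j‖² + (θ − ½) k² ∑_{ℓ=0}^{j−1} ‖G v_ℓ‖² + ((α − ν) k / C_e) ∑_{ℓ=0}^{j−1} ‖v_ℓ‖² ≤ ½‖G m_0‖² + (k / (2 C_e ν)) ∑_{ℓ=0}^{j−1} (‖h_ℓ‖²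 + ‖p_ℓ‖²). -/
open RealInnerProductSpace Finset

/-- Abstract discrete energy estimate (Lemma 5.4): from the tested scheme identity (i)
and the energy decay (ii), one obtains for every `0 < ν < α` and every `j` the bound
`½‖G m_j‖² + (θ − ½) k² ∑ ‖G v_ℓ‖² + ((α − ν) k / C_e) ∑ ‖v_ℓ‖²
  ≤ ½‖G m_0‖² + (k / (2 C_e ν)) ∑ (‖h_ℓ‖² + ‖p_ℓ‖²)`. -/
theorem stmt11 {H K : Type*} [NormedAddCommGroup H] [InnerProductSpace ℝ H]
    [NormedAddCommGroup K] [InnerProductSpace ℝ K]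
    (G : H →ₗ[ℝ] K) (α Ce θ k : ℝ) (hα : 0 < α) (hCe : 0 < Ce) (hk : 0 < k)
    (m v h p : ℕ → H)
    (hi : ∀ ℓ : ℕ, α * ‖v ℓ‖ ^ 2 + Ce * θ * k * ‖G (v ℓ)‖ ^ 2 =
      -(Ce * ⟪G (m ℓ), G (v ℓ)⟫) + ⟪h ℓ - p ℓ, v ℓ⟫)
    (hii : ∀ ℓ : ℕ, ‖G (m (ℓ + 1))‖ ≤ ‖G (m ℓ) + k • G (v ℓ)‖) :
    ∀ ν : ℝ, 0 < ν → ν < α → ∀ j : ℕ,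
      (1 / 2) * ‖G (m j)‖ ^ 2 + (θ - 1 / 2) * k ^ 2 * ∑ ℓ ∈ range j, ‖G (v ℓ)‖ ^ 2
          + ((α - ν) * k / Ce) * ∑ ℓ ∈ range j, ‖v ℓ‖ ^ 2 ≤
        (1 / 2) * ‖G (m 0)‖ ^ 2
          + (k / (2 * Ce * ν)) * ∑ ℓ ∈ range j, (‖h ℓ‖ ^ 2 + ‖p ℓ‖ ^ 2) := by
  intro ν hν _ j
  induction j with
  | zero => simp
  | succ j ih =>
    rw [sum_range_succ, sum_range_succ, sum_range_succ]
    have e := hi j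
    have d : ‖G (m (j + 1))‖ ^ 2 ≤ ‖G (m j) + k • G (v j)‖ ^ 2 :=
      pow_le_pow_left₀ (norm_nonneg _) (hii j) 2
    rw [norm_add_sq_real, norm_smul, mul_pow, inner_smul_right, Real.norm_eq_abs, sq_abs] at d
    have h1 : 0 ≤ ‖h j - ν • v j‖ ^ 2 := sq_nonneg _
    have h2 : 0 ≤ ‖p j + ν • v j‖ ^ 2 := sq_nonneg _
    rw [norm_sub_sq_real, norm_smul, mul_pow, inner_smul_right, Real.norm_eq_abs, sq_abs] at h1
    rw [norm_add_sq_real, norm_smul, mul_pow, inner_smul_right, Real.norm_eq_abs, sq_abs] at h2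
    rw [inner_sub_left] at e
    have key : k * ⟪G (m j), G (v j)⟫ + θ * k ^ 2 * ‖G (v j)‖ ^ 2
        + ((α - ν) * k / Ce) * ‖v j‖ ^ 2
        ≤ (k / (2 * Ce * ν)) * (‖h j‖ ^ 2 + ‖p j‖ ^ 2) := by
      have e2 : k * ⟪G (m j), G (v j)⟫ + θ * k ^ 2 * ‖G (v j)‖ ^ 2
          + ((α - ν) * k / Ce) * ‖v j‖ ^ 2
          = (k / (2 * Ce * ν)) * (2 * ν * (⟪h j, v j⟫ - ⟪p j, v j⟫ - ν * ‖v j‖ ^ 2)) := by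
        field_simp
        linear_combination e
      rw [e2]
      apply mul_le_mul_of_nonneg_left _ (by positivity)
      linarith
    linarith
end
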